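/- arXiv:1911.01957 — 4 statements merged into one kernel-verified Lean document; each statement's English description precedes it below -/
import Mathlib

section
/- Let F be a field of characteristic zero and L a finite-dimensional Lie algebra over F. The lattice of Lie ideals of L is finite and complemented if and only if the Jacobson radical ⁅L, Rad(L)⁆ is zero and the center of L has dimension at most 1. -/
open LieAlgebra

section Lattice

variable {F L : Type*} [Field F] [LieRing L] [LieAlgebra F L]

theorem LieIdeal.lie_eq_bot_of_disjoint {I J : LieIdeal F L} (h : I ⊓ J = ⊥) : ⁅I, J⁆ = ⊥ :=
  eq_bot_iff.mpr (h ▸ LieSubmodule.lie_le_inf I J)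

theorem LieIdeal.eq_bot_of_isSolvable_of_lie_self {D : LieIdeal F L} [hs : IsSolvable D]
    (h : ⁅D, D⁆ = D) : D = ⊥ := by
  obtain ⟨k, hk⟩ := IsSolvable.solvable F D
  rw [LieIdeal.derivedSeries_eq_bot_iff] at hk
  have hD : ∀ n, derivedSeriesOfIdeal F L n D = D := by
    intro n
    induction n with
    | zero => rfl
    | succ n ih => rw [derivedSeriesOfIdeal_succ, ih, h]
  rw [← hk, hD]

theorem LieIdeal.lie_self_eq_bot_of_isSolvable [ComplementedLattice (LieIdeal F L)]
    (R : LieIdeal F L) [hR : IsSolvable R] : ⁅R, R⁆ = ⊥ := by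
  obtain ⟨D, hD⟩ : ∃ D : LieIdeal F L, D = ⁅R, R⁆ := ⟨_, rfl⟩
  have hDR : D ≤ R := hD ▸ LieSubmodule.lie_le_left R R
  obtain ⟨C, hC⟩ := exists_isCompl D
  have hsup : D ⊔ C ⊓ R = R := by
    rw [← sup_inf_assoc_of_le C hDR, hC.sup_eq_top, top_inf_eq]
  have hcomm : ⁅R, C ⊓ R⁆ = ⊥ := by
    rw [eq_bot_iff, ← hC.inf_eq_bot]
    exact le_inf (hD ▸ LieSubmodule.mono_lie_right R inf_le_right)
      ((LieSubmodule.lie_le_right (C ⊓ R) R).trans inf_le_left)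
  have hRD : ⁅R, D⁆ = D := by
    have h : ⁅R, D ⊔ C ⊓ R⁆ = ⁅R, D⁆ := by rw [LieSubmodule.lie_sup, hcomm, sup_bot_eq]
    rw [← h, hsup, hD]
  have hCD : ⁅C ⊓ R, D⁆ = ⊥ := by
    rw [eq_bot_iff, ← hcomm, LieSubmodule.lie_comm]
    exact LieSubmodule.mono_lie_left _ hDR
  have hDD : ⁅D, D⁆ = D := by
    have h : ⁅D ⊔ C ⊓ R, D⁆ = ⁅D, D⁆ := by rw [LieSubmodule.sup_lie, hCD, sup_bot_eq]
    rw [← h, hsup, hRD]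
  have : IsSolvable D := LieAlgebra.le_solvable_ideal_solvable hDR hR
  rw [← hD, LieIdeal.eq_bot_of_isSolvable_of_lie_self hDD]

theorem LieAlgebra.lie_top_radical_eq_bot [FiniteDimensional F L]
    [ComplementedLattice (LieIdeal F L)] : ⁅(⊤ : LieIdeal F L), radical F L⁆ = ⊥ := by
  obtain ⟨J, hJ⟩ := exists_isCompl (radical F L)
  rw [← hJ.sup_eq_top, LieSubmodule.sup_lie, LieIdeal.lie_self_eq_bot_of_isSolvable,
    LieSubmodule.lie_comm, LieIdeal.lie_eq_bot_of_disjoint hJ.inf_eq_bot, sup_idem]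

theorem LieAlgebra.finrank_center_le_one [Infinite F] [FiniteDimensional F L]
    [Finite (LieIdeal F L)] : Module.finrank F (center F L) ≤ 1 := by
  by_contra! h
  obtain ⟨u, hu⟩ := Module.finrank_pos_iff_exists_ne_zero.mp (zero_lt_one.trans h)
  obtain ⟨v, hv⟩ := exists_linearIndependent_pair_of_one_lt_finrank h hu
  let line (a : F) : LieIdeal F L :=
    { Submodule.span F {(u + a • v : L)} with
      lie_mem := by
        intro x m hm
        obtain ⟨c, rfl⟩ := Submodule.mem_span_singleton.mp hm
        have : ⁅x, c • ((u : L) + a • (v : L))⁆ = 0 :=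
          (c • (u + a • v)).2 x
        change ⁅x, c • ((u : L) + a • (v : L))⁆ ∈ Submodule.span F {(u + a • v : L)}
        rw [this]
        exact zero_mem _ }
  refine not_injective_infinite_finite line fun a b hab => ?_
  have hm : (u + a • v : L) ∈ line b := hab ▸ Submodule.mem_span_singleton_self _
  obtain ⟨c, hc⟩ := Submodule.mem_span_singleton.mp hm
  have hc' : (c - 1) • u + (c * b - a) • v = 0 := by
    have : c • (u + b • v) = u + a • v := Subtype.ext hc
    rw [← sub_eq_zero.mpr this]
    module
  obtain ⟨h1, h2⟩ := LinearIndependent.pair_iff.mp hv _ _ hc'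
  linear_combination b * h1 - h2

end Lattice

section Quotient

variable {F L : Type*} [Field F] [LieRing L] [LieAlgebra F L]

/-- The projection of a Lie algebra onto the quotient by an ideal, as a Lie algebra morphism. -/
def LieIdeal.quotientHom (I : LieIdeal F L) : L →ₗ⁅F⁆ L ⧸ I :=
  { (LieSubmodule.Quotient.mk' I : L →ₗ[F] L ⧸ I) with
    map_lie' := fun {_ _} => rfl }

theorem LieIdeal.quotientHom_surjective (I : LieIdeal F L) :
    Function.Surjective I.quotientHom :=
  LieSubmodule.Quotient.surjective_mk' I

theorem LieIdeal.quotientHom_eq_zero_iff (I : LieIdeal F L) {x : L} :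
    I.quotientHom x = 0 ↔ x ∈ I :=
  LieSubmodule.Quotient.mk_eq_zero' (N := I)

theorem LieIdeal.ker_quotientHom (I : LieIdeal F L) : I.quotientHom.ker = I := by
  ext x
  rw [LieHom.mem_ker, I.quotientHom_eq_zero_iff]

theorem LieIdeal.comap_map_quotientHom (Z I : LieIdeal F L) :
    (I.map Z.quotientHom).comap Z.quotientHom = I ⊔ Z := by
  have h := LieIdeal.coe_map_of_surjective (I := I) Z.quotientHom_surjective
  rw [LieIdeal.comap_map_eq (congrArg (fun N : Submodule F (L ⧸ Z) => (N : Set (L ⧸ Z))) h),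
    Z.ker_quotientHom]

theorem LieIdeal.map_comap_quotientHom (Z : LieIdeal F L) (J : LieIdeal F (L ⧸ Z)) :
    (J.comap Z.quotientHom).map Z.quotientHom = J := by
  rw [LieIdeal.map_comap_eq (LieHom.isIdealMorphism_of_surjective _ Z.quotientHom_surjective),
    LieHom.idealRange_eq_top_of_surjective _ Z.quotientHom_surjective, top_inf_eq]

theorem LieAlgebra.hasTrivialRadical_quotient_radical [FiniteDimensional F L] :
    HasTrivialRadical F (L ⧸ radical F L) := by
  rw [hasTrivialRadical_iff_no_abelian_ideals]
  intro I hI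
  set p := (radical F L).quotientHom with hp
  have hlie : derivedSeriesOfIdeal F L 1 (I.comap p) ≤ radical F L := by
    rw [derivedSeriesOfIdeal_succ, derivedSeriesOfIdeal_zero]
    refine (LieIdeal.comap_bracket_le p).trans ?_
    rw [(LieSubmodule.lie_abelian_iff_lie_self_eq_bot I).mp hI, ← LieHom.ker, hp,
      LieIdeal.ker_quotientHom]
  obtain ⟨k, hk⟩ := IsSolvable.solvable F (radical F L)
  rw [LieIdeal.derivedSeries_eq_bot_iff] at hk
  have hs : derivedSeries F (I.comap p) (k + 1) = ⊥ := by
    rw [LieIdeal.derivedSeries_eq_bot_iff, derivedSeriesOfIdeal_add, eq_bot_iff, ← hk]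
    exact derivedSeriesOfIdeal_mono hlie k
  have hle := (LieIdeal.solvable_iff_le_radical F L _).mp (IsSolvable.mk hs)
  rw [← LieIdeal.map_comap_quotientHom _ I, eq_bot_iff, LieIdeal.map_le_iff_le_comap]
  rwa [← LieHom.ker, LieIdeal.ker_quotientHom]

end Quotient

section Semisimple

variable {F L : Type*} [Field F] [LieRing L] [LieAlgebra F L]

theorem LieIdeal.lie_top_eq_self [ComplementedLattice (LieIdeal F L)] [HasTrivialRadical F L]
    (I : LieIdeal F L) : ⁅(⊤ : LieIdeal F L), I⁆ = I := by
  obtain ⟨C, hC⟩ := exists_isCompl ⁅(⊤ : LieIdeal F L), I⁆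
  have hle : ⁅(⊤ : LieIdeal F L), I⁆ ≤ I := LieSubmodule.lie_le_right _ _
  have hsup : ⁅(⊤ : LieIdeal F L), I⁆ ⊔ C ⊓ I = I := by
    rw [← sup_inf_assoc_of_le C hle, hC.sup_eq_top, top_inf_eq]
  have hab : C ⊓ I = ⊥ := by
    refine hasTrivialRadical_iff_no_abelian_ideals F L |>.mp inferInstance _ ?_
    rw [LieSubmodule.lie_abelian_iff_lie_self_eq_bot, eq_bot_iff, ← hC.inf_eq_bot]
    exact le_inf (LieSubmodule.mono_lie le_top inf_le_right)
      ((LieSubmodule.lie_le_right _ _).trans inf_le_left)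
  rwa [hab, sup_bot_eq] at hsup

theorem LieAlgebra.IsSemisimple.finite_lieIdeal [FiniteDimensional F L] [IsSemisimple F L] :
    Finite (LieIdeal F L) := by
  have hfin : {I : LieIdeal F L | IsAtom I}.Finite :=
    WellFoundedGT.finite_of_sSupIndep IsSemisimple.sSupIndep_isAtom
  have : Finite (Set.powerset {I : LieIdeal F L | IsAtom I}) := hfin.powerset
  refine Finite.of_surjective
    (fun s : Set.powerset {I : LieIdeal F L | IsAtom I} => sSup (s : Set (LieIdeal F L)))
    fun I => ?_
  obtain ⟨s, hs, rfl⟩ := (IsSemisimple.booleanGenerators F L).atomistic I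
    (IsSemisimple.sSup_atoms_eq_top (R := F) (L := L) ▸ le_top)
  exact ⟨⟨s, hs⟩, rfl⟩

/-- A scalar 2-cocycle on a Killing Lie algebra is a coboundary. -/
theorem LieAlgebra.IsKilling.exists_killingForm_lie_eq [FiniteDimensional F L] [IsKilling F L]
    (ω : L →ₗ[F] L →ₗ[F] F)
    (hω : ∀ x y z, ω ⁅x, y⁆ z = ω x ⁅y, z⁆ - ω y ⁅x, z⁆) :
    ∃ s, ∀ x y, ω x y = killingForm F L s ⁅x, y⁆ := by
  have hnd := IsKilling.killingForm_nondegenerate F L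
  let D : L →ₗ[F] L := (LinearMap.BilinForm.toDual (killingForm F L) hnd).symm.toLinearMap ∘ₗ ω
  have hD : ∀ x y, killingForm F L (D x) y = ω x y := fun x y =>
    LinearMap.BilinForm.apply_toDual_symm_apply (hB := hnd) (ω x) y
  let δ : LieDerivation F L L :=
    { D with
      leibniz' := by
        intro x y
        change D ⁅x, y⁆ = ⁅x, D y⁆ - ⁅y, D x⁆
        apply (LinearMap.BilinForm.toDual (killingForm F L) hnd).injective
        ext z
        rw [LinearMap.BilinForm.toDual_def, LinearMap.BilinForm.toDual_def, hD, hω, map_sub,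
          LinearMap.sub_apply, ← lie_skew x (D y), ← lie_skew y (D x), map_neg,
          map_neg, LinearMap.neg_apply, LinearMap.neg_apply, LieModule.traceForm_apply_lie_apply,
          LieModule.traceForm_apply_lie_apply, hD, hD]
        ring }
  obtain ⟨s, hs⟩ := LieDerivation.IsKilling.exists_eq_ad δ
  refine ⟨s, fun x y => ?_⟩
  have : D x = ⁅s, x⁆ := by
    rw [← LieAlgebra.ad_apply F, ← LieDerivation.coe_ad_apply_eq_ad_apply, hs]
  rw [← hD, this, LieModule.traceForm_apply_lie_apply]

theorem LieAlgebra.lie_top_sup_center_right (I : LieIdeal F L) :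
    ⁅(⊤ : LieIdeal F L), I ⊔ center F L⁆ = ⁅(⊤ : LieIdeal F L), I⁆ := by
  have : ⁅(⊤ : LieIdeal F L), center F L⁆ = ⊥ :=
    LieSubmodule.lie_eq_bot_iff _ _ |>.mpr fun x _ m hm => hm x
  rw [LieSubmodule.lie_sup, this, sup_bot_eq]

end Semisimple

section Reductive

variable {F L : Type*} [Field F] [LieRing L] [LieAlgebra F L] [FiniteDimensional F L]

theorem LieAlgebra.center_inf_lie_top [IsKilling F (L ⧸ center F L)] :
    center F L ⊓ ⁅(⊤ : LieIdeal F L), (⊤ : LieIdeal F L)⁆ = ⊥ := by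
  rw [eq_bot_iff]
  rintro z ⟨hz, hz'⟩
  by_contra hne
  obtain ⟨f, hf⟩ : ∃ f : Module.Dual F L, f z ≠ 0 := by
    by_contra! h
    exact hne ((Module.forall_dual_apply_eq_zero_iff F z).mp h)
  set p := (center F L).quotientHom with hp
  let ω₀ : L →ₗ[F] L →ₗ[F] F := (LieModule.toEnd F L L : L →ₗ[F] Module.End F L).compr₂ f
  have hω₀ : ∀ x y, ω₀ x y = f ⁅x, y⁆ := fun _ _ => rfl
  let ω : (L ⧸ center F L) →ₗ[F] (L ⧸ center F L) →ₗ[F] F :=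
    Submodule.liftQ _
      (LinearMap.flip (Submodule.liftQ _ ω₀.flip (by
        intro c hc
        ext x
        change f ⁅x, c⁆ = 0
        rw [hc x, map_zero])))
      (by
        intro c hc
        ext x
        obtain ⟨x, rfl⟩ := (center F L).quotientHom_surjective x
        change f ⁅c, x⁆ = 0
        rw [← lie_skew, hc x, neg_zero, map_zero])
  have hω : ∀ x y, ω (p x) (p y) = f ⁅x, y⁆ := fun _ _ => rfl
  obtain ⟨s, hs⟩ := IsKilling.exists_killingForm_lie_eq ω (by
    intro x y w
    obtain ⟨x, rfl⟩ := (center F L).quotientHom_surjective x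
    obtain ⟨y, rfl⟩ := (center F L).quotientHom_surjective y
    obtain ⟨w, rfl⟩ := (center F L).quotientHom_surjective w
    rw [← hp, ← LieHom.map_lie, ← LieHom.map_lie, ← LieHom.map_lie, hω, hω, hω, lie_lie, map_sub])
  have key : ∀ u ∈ ⁅(⊤ : LieIdeal F L), (⊤ : LieIdeal F L)⁆, f u = killingForm F _ s (p u) := by
    intro u hu
    rw [← LieSubmodule.mem_toSubmodule, LieSubmodule.lieIdeal_oper_eq_linear_span'] at hu
    induction hu using Submodule.span_induction with
    | mem u hu =>
      obtain ⟨x, -, y, -, rfl⟩ := hu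
      rw [← hω, hs, LieHom.map_lie]
    | zero => simp
    | add u v _ _ hu hv => rw [map_add, map_add, map_add, hu, hv]
    | smul c u _ hu => rw [map_smul, map_smul, map_smul, hu]
  apply hf
  rw [key z hz', (center F L).quotientHom_eq_zero_iff.mpr hz, map_zero]

theorem LieAlgebra.le_or_inf_eq_bot_of_finrank_le_one {Z : LieIdeal F L}
    (h : Module.finrank F Z ≤ 1) (I : LieIdeal F L) : Z ≤ I ∨ I ⊓ Z = ⊥ := by
  by_contra! hc
  obtain ⟨hle, hne⟩ := hc
  obtain ⟨v, hv, hv0⟩ := (by simpa [LieSubmodule.eq_bot_iff, and_assoc] using hne :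
    ∃ v ∈ I ⊓ Z, v ≠ 0)
  refine hle fun z hz => ?_
  obtain ⟨c, hc⟩ := exists_smul_eq_of_finrank_eq_one
    (le_antisymm h (Module.finrank_pos_iff_exists_ne_zero.mpr
      ⟨(⟨v, hv.2⟩ : Z), fun h0 => hv0 (congrArg Subtype.val h0)⟩))
    (x := (⟨v, hv.2⟩ : Z)) (fun h0 => hv0 (congrArg Subtype.val h0)) ⟨z, hz⟩
  have hcz : c • v = z := congrArg Subtype.val hc
  exact hcz ▸ I.smul_mem c hv.1

variable [IsKilling F (L ⧸ center F L)]

theorem LieAlgebra.lie_top_sup_center (I : LieIdeal F L) :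
    ⁅(⊤ : LieIdeal F L), I⁆ ⊔ center F L = I ⊔ center F L := by
  have hs := (center F L).quotientHom_surjective
  have htop : (⊤ : LieIdeal F L).map (center F L).quotientHom = ⊤ := by
    rw [← LieHom.idealRange_eq_map, LieHom.idealRange_eq_top_of_surjective _ hs]
  rw [← LieIdeal.comap_map_quotientHom, LieIdeal.map_bracket_eq _ hs, htop,
    LieIdeal.lie_top_eq_self, LieIdeal.comap_map_quotientHom]

theorem LieAlgebra.lie_top_eq_self_of_inf_center {I : LieIdeal F L} (h : I ⊓ center F L = ⊥) :
    ⁅(⊤ : LieIdeal F L), I⁆ = I := by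
  have hle : ⁅(⊤ : LieIdeal F L), I⁆ ≤ I := LieSubmodule.lie_le_right _ _
  have : (⁅(⊤ : LieIdeal F L), I⁆ ⊔ center F L) ⊓ I = I := by
    rw [lie_top_sup_center, inf_eq_right]
    exact le_sup_left
  rwa [sup_inf_assoc_of_le _ hle, inf_comm, h, sup_bot_eq] at this

theorem LieAlgebra.finite_lieIdeal_of_finrank_center_le_one
    (h : Module.finrank F (center F L) ≤ 1) : Finite (LieIdeal F L) := by
  have := IsSemisimple.finite_lieIdeal (F := F) (L := L ⧸ center F L)
  refine Finite.of_injective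
    (fun I : LieIdeal F L => (I.map (center F L).quotientHom, center F L ≤ I)) fun I J hIJ => ?_
  obtain ⟨hmap, hle⟩ := Prod.ext_iff.mp hIJ
  have hsup : I ⊔ center F L = J ⊔ center F L := by
    rw [← LieIdeal.comap_map_quotientHom, ← LieIdeal.comap_map_quotientHom]
    exact congrArg _ hmap
  have hle : center F L ≤ I ↔ center F L ≤ J := iff_of_eq hle
  by_cases hI : center F L ≤ I
  · rwa [sup_eq_left.mpr hI, sup_eq_left.mpr (hle.mp hI)] at hsup
  · rw [← lie_top_eq_self_of_inf_center
        ((le_or_inf_eq_bot_of_finrank_le_one h I).resolve_left hI),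
      ← lie_top_eq_self_of_inf_center
        ((le_or_inf_eq_bot_of_finrank_le_one h J).resolve_left (hle.not.mp hI)),
      ← lie_top_sup_center_right I, hsup, lie_top_sup_center_right]

theorem LieAlgebra.complementedLattice_of_finrank_center_le_one
    (h : Module.finrank F (center F L) ≤ 1) : ComplementedLattice (LieIdeal F L) := by
  refine ⟨fun I => ?_⟩
  obtain ⟨C, hC⟩ := exists_isCompl (I.map (center F L).quotientHom)
  set K := C.comap (center F L).quotientHom with hK
  have hZK : center F L ≤ K := by
    conv_lhs => rw [← (center F L).ker_quotientHom]
    exact LieIdeal.comap_mono bot_le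
  have hsup : I ⊔ K = ⊤ := by
    have : (I ⊔ K) ⊔ center F L = ⊤ := by
      rw [← LieIdeal.comap_map_quotientHom, LieIdeal.map_sup, hK, LieIdeal.map_comap_quotientHom,
        hC.sup_eq_top, eq_top_iff]
      exact fun _ _ => LieSubmodule.mem_top _
    rwa [sup_assoc, sup_eq_left.mpr hZK] at this
  have hinf : (I ⊔ center F L) ⊓ K = center F L := by
    have : (I.map (center F L).quotientHom ⊓ C).comap (center F L).quotientHom = center F L := by
      rw [hC.inf_eq_bot, ← LieHom.ker, LieIdeal.ker_quotientHom]
    rw [← LieIdeal.comap_map_quotientHom]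
    conv_rhs => rw [← this]
    rfl
  rcases le_or_inf_eq_bot_of_finrank_le_one h I with hI | hI
  · refine ⟨⁅(⊤ : LieIdeal F L), K⁆, IsCompl.of_eq ?_ ?_⟩
    · rw [eq_bot_iff, ← center_inf_lie_top (F := F) (L := L)]
      refine le_inf ?_ (inf_le_right.trans (LieSubmodule.mono_lie_right _ le_top))
      conv_rhs => rw [← hinf]
      exact inf_le_inf le_sup_left (LieSubmodule.lie_le_right _ _)
    · rw [← sup_eq_left.mpr hI, sup_assoc, sup_comm (center F L), lie_top_sup_center,
        sup_eq_left.mpr hZK, hsup]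
  · refine ⟨K, IsCompl.of_eq ?_ hsup⟩
    rw [eq_bot_iff, ← hI]
    refine le_inf inf_le_left ?_
    conv_rhs => rw [← hinf]
    exact inf_le_inf_right K le_sup_left

end Reductive

/-- The lattice of Lie ideals of a finite-dimensional Lie algebra over a field of
characteristic zero is finite and complemented iff the Jacobson radical
`⁅L, Rad L⁆` vanishes and the centre has dimension at most `1`. -/
theorem finite_complemented_lieIdeal_lattice_iff
    (F : Type*) [Field F] [CharZero F]
    (L : Type*) [LieRing L] [LieAlgebra F L] [FiniteDimensional F L] :
    (Finite (LieIdeal F L) ∧ ComplementedLattice (LieIdeal F L)) ↔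
      (⁅(⊤ : LieIdeal F L), LieAlgebra.radical F L⁆ = (⊥ : LieIdeal F L) ∧
        Module.finrank F (LieAlgebra.center F L) ≤ 1) := by
  constructor
  · rintro ⟨hfin, hcompl⟩
    exact ⟨lie_top_radical_eq_bot, finrank_center_le_one⟩
  · rintro ⟨hrad, hdim⟩
    have hle : radical F L ≤ center F L := fun m hm x =>
      LieSubmodule.lie_eq_bot_iff _ _ |>.mp hrad x (LieSubmodule.mem_top x) m hm
    have hZ : radical F L = center F L := le_antisymm hle (center_le_radical F L)
    have htriv : HasTrivialRadical F (L ⧸ center F L) :=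
      hZ ▸ hasTrivialRadical_quotient_radical
    exact ⟨finite_lieIdeal_of_finrank_center_le_one hdim,
      complementedLattice_of_finrank_center_le_one hdim⟩
end

section
/- Let F be a field of characteristic zero, let L₁ be a finite-dimensional semisimple Lie algebra over F, and let L₂ be any finite-dimensional Lie algebra over F. Then every Lie ideal of the product Lie algebra L₁ × L₂ is of the form I₁ × I₂ with I₁ a Lie ideal of L₁ and I₂ a Lie ideal of L₂; consequently the lattice of Lie ideals of L₁ × L₂ is order-isomorphic to the product of the lattice of Lie ideals of L₁ and the lattice of Lie ideals of L₂. -/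
section ProdLieAlgebra

variable (F : Type*) [Field F]
variable (L₁ L₂ : Type*) [LieRing L₁] [LieAlgebra F L₁] [LieRing L₂] [LieAlgebra F L₂]

/-- The componentwise Lie ring structure on the product `L₁ × L₂`. -/
instance Prod.instLieRing : LieRing (L₁ × L₂) where
  bracket x y := (⁅x.1, y.1⁆, ⁅x.2, y.2⁆)
  add_lie _ _ _ := Prod.ext (add_lie _ _ _) (add_lie _ _ _)
  lie_add _ _ _ := Prod.ext (lie_add _ _ _) (lie_add _ _ _)
  lie_self _ := Prod.ext (lie_self _) (lie_self _)
  leibniz_lie _ _ _ := Prod.ext (leibniz_lie _ _ _) (leibniz_lie _ _ _)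

/-- The componentwise Lie algebra structure on the product `L₁ × L₂`. -/
instance Prod.instLieAlgebraProd : LieAlgebra F (L₁ × L₂) where
  lie_smul _ _ _ := Prod.ext (lie_smul _ _ _) (lie_smul _ _ _)

end ProdLieAlgebra

section LieIdealProd

variable {F L₁ L₂ : Type*} [Field F]
variable [LieRing L₁] [LieAlgebra F L₁] [LieRing L₂] [LieAlgebra F L₂]

/-- Every ideal of a semisimple Lie algebra `L` satisfies `⁅L, J⁆ = J`. -/
theorem LieIdeal.top_lie_eq_self_of_isSemisimple [LieAlgebra.IsSemisimple F L₁]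
    (J : LieIdeal F L₁) : ⁅(⊤ : LieIdeal F L₁), J⁆ = J := by
  refine le_antisymm (LieSubmodule.lie_le_right J ⊤) ?_
  set D : LieIdeal F L₁ := ⁅(⊤ : LieIdeal F L₁), J⁆
  have h_center : J ⊓ Dᶜ ≤ LieAlgebra.center F L₁ := by
    intro x hx
    refine (LieModule.mem_maxTrivSubmodule F L₁ L₁ x).mpr fun y ↦ ?_
    have h_mem : ⁅y, x⁆ ∈ D ⊓ Dᶜ :=
      ⟨LieSubmodule.lie_mem_lie (LieSubmodule.mem_top y) hx.1, lie_mem_right F L₁ Dᶜ y x hx.2⟩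
    exact (LieSubmodule.mem_bot _).mp ((disjoint_compl_right (a := D)).le_bot h_mem)
  rw [LieAlgebra.center_eq_bot] at h_center
  exact le_of_inf_le_sup_le (z := Dᶜ) (h_center.trans bot_le) (by
    rw [show D ⊔ Dᶜ = ⊤ from sup_compl_eq_top]; exact le_top)

namespace LieIdeal

/-- The product of two Lie ideals, as an ideal of the product Lie algebra. -/
def prod (I₁ : LieIdeal F L₁) (I₂ : LieIdeal F L₂) : LieIdeal F (L₁ × L₂) where
  toSubmodule := I₁.toSubmodule.prod I₂.toSubmodule
  lie_mem {x m} hm := ⟨lie_mem_right F L₁ I₁ x.1 m.1 hm.1, lie_mem_right F L₂ I₂ x.2 m.2 hm.2⟩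

/-- The projection to the first factor of an ideal of a product Lie algebra. -/
def prodFst (I : LieIdeal F (L₁ × L₂)) : LieIdeal F L₁ where
  toSubmodule := I.toSubmodule.map (LinearMap.fst F L₁ L₂)
  lie_mem {c a} := by
    rintro ⟨x, hx, rfl⟩
    exact ⟨⁅(c, (0 : L₂)), x⁆, lie_mem_right F (L₁ × L₂) I _ x hx, rfl⟩

/-- The projection to the second factor of an ideal of a product Lie algebra. -/
def prodSnd (I : LieIdeal F (L₁ × L₂)) : LieIdeal F L₂ where
  toSubmodule := I.toSubmodule.map (LinearMap.snd F L₁ L₂)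
  lie_mem {c b} := by
    rintro ⟨x, hx, rfl⟩
    exact ⟨⁅((0 : L₁), c), x⁆, lie_mem_right F (L₁ × L₂) I _ x hx, rfl⟩

theorem prodFst_prod (I₁ : LieIdeal F L₁) (I₂ : LieIdeal F L₂) : (I₁.prod I₂).prodFst = I₁ := by
  ext a
  exact ⟨fun ⟨_, hx, h⟩ ↦ h ▸ hx.1, fun ha ↦ ⟨(a, 0), ⟨ha, I₂.zero_mem⟩, rfl⟩⟩

theorem prodSnd_prod (I₁ : LieIdeal F L₁) (I₂ : LieIdeal F L₂) : (I₁.prod I₂).prodSnd = I₂ := by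
  ext b
  exact ⟨fun ⟨_, hx, h⟩ ↦ h ▸ hx.2, fun hb ↦ ⟨(0, b), ⟨I₁.zero_mem, hb⟩, rfl⟩⟩

theorem mk_zero_mem_of_mem_prodFst [LieAlgebra.IsSemisimple F L₁] {I : LieIdeal F (L₁ × L₂)}
    {a : L₁} (ha : a ∈ I.prodFst) : (a, (0 : L₂)) ∈ I := by
  rw [← top_lie_eq_self_of_isSemisimple I.prodFst, ← LieSubmodule.mem_toSubmodule,
    LieSubmodule.lieIdeal_oper_eq_linear_span'] at ha
  induction ha using Submodule.span_induction with
  | mem _ h =>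
    obtain ⟨c, -, _, ⟨x, hx, rfl⟩, rfl⟩ := h
    have h_lie : ⁅(c, (0 : L₂)), x⁆ = (⁅c, x.1⁆, (0 : L₂)) := Prod.ext rfl (zero_lie x.2)
    exact h_lie ▸ lie_mem_right F (L₁ × L₂) I (c, 0) x hx
  | zero => exact I.zero_mem
  | add x y _ _ hx hy => simpa using I.add_mem hx hy
  | smul t x _ hx => simpa using I.smul_mem t hx

theorem prod_prodFst_prodSnd [LieAlgebra.IsSemisimple F L₁] (I : LieIdeal F (L₁ × L₂)) :
    I.prodFst.prod I.prodSnd = I := by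
  ext ⟨a, b⟩
  refine ⟨?_, fun h ↦ ⟨⟨_, h, rfl⟩, ⟨_, h, rfl⟩⟩⟩
  rintro ⟨ha, ⟨⟨a', b⟩, h, rfl⟩⟩
  have ha' : a - a' ∈ I.prodFst := sub_mem ha ⟨_, h, rfl⟩
  simpa using I.add_mem (mk_zero_mem_of_mem_prodFst ha') h

/-- If `L₁` is semisimple, the ideals of `L₁ × L₂` are the products of ideals of the factors. -/
def prodOrderIso [LieAlgebra.IsSemisimple F L₁] :
    LieIdeal F (L₁ × L₂) ≃o LieIdeal F L₁ × LieIdeal F L₂ where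
  toFun I := (I.prodFst, I.prodSnd)
  invFun p := p.1.prod p.2
  left_inv := prod_prodFst_prodSnd
  right_inv p := Prod.ext (prodFst_prod p.1 p.2) (prodSnd_prod p.1 p.2)
  map_rel_iff' {I J} := by
    refine ⟨fun h ↦ ?_, fun h ↦ ⟨Submodule.map_mono h, Submodule.map_mono h⟩⟩
    rw [← prod_prodFst_prodSnd I, ← prod_prodFst_prodSnd J]
    exact Submodule.prod_mono h.1 h.2

end LieIdeal

end LieIdealProd

/-- If `L₁` is a finite-dimensional semisimple Lie algebra and `L₂` any finite-dimensional
Lie algebra over a field of characteristic zero, then every Lie ideal of `L₁ × L₂` is a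
product `I₁ × I₂` of ideals of the factors, and the ideal lattice of `L₁ × L₂` is
order-isomorphic to the product of the ideal lattices of `L₁` and `L₂`. -/
theorem lieIdeal_prod_of_isSemisimple
    (F : Type*) [Field F] [CharZero F]
    (L₁ L₂ : Type*) [LieRing L₁] [LieAlgebra F L₁] [LieRing L₂] [LieAlgebra F L₂]
    [FiniteDimensional F L₁] [FiniteDimensional F L₂]
    [LieAlgebra.IsSemisimple F L₁] :
    (∀ I : LieIdeal F (L₁ × L₂), ∃ (I₁ : LieIdeal F L₁) (I₂ : LieIdeal F L₂),
        (I : Set (L₁ × L₂)) = (I₁ : Set L₁) ×ˢ (I₂ : Set L₂)) ∧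
      Nonempty (LieIdeal F (L₁ × L₂) ≃o LieIdeal F L₁ × LieIdeal F L₂) := by
  refine ⟨fun I ↦ ⟨I.prodFst, I.prodSnd, ?_⟩, ⟨LieIdeal.prodOrderIso⟩⟩
  exact congrArg (fun J : LieIdeal F (L₁ × L₂) ↦ (J : Set (L₁ × L₂)))
    (LieIdeal.prod_prodFst_prodSnd I).symm
end

section
/- Let F be a field of characteristic zero and L a finite-dimensional Lie algebra over F with only finitely many Lie ideals. Suppose L has trivial center and has no Lie ideal that is a simple Lie algebra. Then every nonzero Lie ideal I of L satisfies I ⊓ ⁅L, Rad(L)⁆ ≠ ⊥, where Rad(L) is the solvable radical of L. -/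
namespace LieAlgebra

/-- Simplicity of a Lie algebra is invariant under isomorphism. -/
theorem IsSimple.of_equiv {R L L' : Type*} [CommRing R] [LieRing L] [LieAlgebra R L]
    [LieRing L'] [LieAlgebra R L'] (e : L ≃ₗ⁅R⁆ L') [IsSimple R L] : IsSimple R L' where
  eq_bot_or_eq_top J := by
    rcases IsSimple.eq_bot_or_eq_top (J.comap e.toLieHom) with h | h
    · left
      rw [LieSubmodule.eq_bot_iff]
      intro x hx
      have hmem : e.symm x ∈ J.comap e.toLieHom := by simpa using hx
      rw [h, LieSubmodule.mem_bot] at hmem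
      simpa using congrArg e hmem
    · right
      refine eq_top_iff.mpr fun x _ ↦ ?_
      have hmem : e.symm x ∈ J.comap e.toLieHom := h ▸ LieSubmodule.mem_top _
      simpa using hmem
  non_abelian h :=
    IsSimple.non_abelian R (L := L) ((lie_abelian_iff_equiv_lie_abelian e).mpr h)

end LieAlgebra

namespace LieIdeal

section CommRing

variable {R L : Type*} [CommRing R] [LieRing L] [LieAlgebra R L]

/-- A perfect ideal of an ideal is stable under the ambient Lie algebra. -/
theorem lie_coe_mem_map_subtype_of_lie_self_eq {I : LieIdeal R L} {K : LieIdeal R I}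
    (hK : ⁅K, K⁆ = K) (x : L) {y : L} (hy : y ∈ K.toSubmodule.map I.toSubmodule.subtype) :
    ⁅x, y⁆ ∈ K.toSubmodule.map I.toSubmodule.subtype := by
  obtain ⟨k, hk, rfl⟩ := hy
  have hspan : k ∈ Submodule.span R {⁅a, b⁆ | (a ∈ K) (b ∈ K)} := by
    rw [← LieSubmodule.lieIdeal_oper_eq_linear_span', hK]
    exact hk
  clear hk
  induction hspan using Submodule.span_induction with
  | mem z hz =>
    obtain ⟨a, ha, b, hb, rfl⟩ := hz
    refine ⟨⁅(⟨⁅x, (a : L)⁆, I.lie_mem a.2⟩ : I), b⁆ + ⁅a, (⟨⁅x, (b : L)⁆, I.lie_mem b.2⟩ : I)⁆,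
      add_mem (K.lie_mem hb) (lie_mem_left R I K _ _ ha), ?_⟩
    simp
  | zero => simp
  | add u v _ _ hu hv => simpa using add_mem hu hv
  | smul t u _ hu => simpa using Submodule.smul_mem _ t hu

/-- A perfect ideal of an ideal, regarded as an ideal of the ambient Lie algebra. -/
def ofPerfect {I : LieIdeal R L} (K : LieIdeal R I) (hK : ⁅K, K⁆ = K) : LieIdeal R L where
  __ := K.toSubmodule.map I.toSubmodule.subtype
  lie_mem := lie_coe_mem_map_subtype_of_lie_self_eq hK _

/-- A perfect ideal of an ideal is isomorphic to its image in the ambient Lie algebra. -/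
noncomputable def equivOfPerfect {I : LieIdeal R L} (K : LieIdeal R I) (hK : ⁅K, K⁆ = K) :
    K ≃ₗ⁅R⁆ ofPerfect K hK where
  __ := Submodule.equivMapOfInjective I.toSubmodule.subtype Subtype.val_injective K.toSubmodule
  map_lie' := rfl

theorem inf_radical_eq_bot {I : LieIdeal R L} (hz : LieAlgebra.center R L = ⊥)
    (h : I ⊓ ⁅(⊤ : LieIdeal R L), LieAlgebra.radical R L⁆ = ⊥) :
    I ⊓ LieAlgebra.radical R L = ⊥ := by
  rw [eq_bot_iff, ← hz]
  intro x hx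
  rw [LieModule.mem_maxTrivSubmodule]
  intro y
  rw [← LieSubmodule.mem_bot (R := R) (L := L), ← h]
  exact ⟨I.lie_mem hx.1, LieSubmodule.lie_mem_lie (LieSubmodule.mem_top y) hx.2⟩

end CommRing

section Field

variable {F L : Type*} [Field F] [CharZero F] [LieRing L] [LieAlgebra F L] [FiniteDimensional F L]

theorem isKilling_of_inf_radical_eq_bot {I : LieIdeal F L}
    (h : I ⊓ LieAlgebra.radical F L = ⊥) : LieAlgebra.IsKilling F I where
  killingCompl_top_eq_bot := by
    have hsolv : LieAlgebra.IsSolvable (I ⊓ I.killingCompl : LieIdeal F L) := by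
      refine isSolvable_of_killingForm_apply_lie_eq_zero _ fun x hx y hy ↦ ?_
      rw [LieModule.traceForm_comm]
      exact (I.mem_killingCompl F L).mp hx.2 y (LieSubmodule.lie_le_left _ _ hy).1
    rw [LieSubmodule.eq_bot_iff]
    intro x hx
    have hmem : (x : L) ∈ I ⊓ LieAlgebra.radical F L := by
      refine ⟨x.2, (LieAlgebra.LieIdeal.solvable_iff_le_radical F L _).mp hsolv
        ⟨x.2, (I.mem_killingCompl F L).mpr fun y hy ↦ ?_⟩⟩
      have := (mem_killingCompl F I ⊤).mp hx ⟨y, hy⟩ (LieSubmodule.mem_top _)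
      rwa [I.killingForm_eq] at this
    rw [h, LieSubmodule.mem_bot] at hmem
    exact Subtype.ext hmem

end Field

end LieIdeal

/-- A faithful (no simple ideals) and centreless finite-dimensional Lie algebra over a
field of characteristic zero with finitely many Lie ideals has the property that every
nonzero ideal meets the Jacobson radical nontrivially. -/
theorem inf_jacobson_ne_bot_of_faithful_centreless
    (F : Type*) [Field F] [CharZero F]
    (L : Type*) [LieRing L] [LieAlgebra F L] [FiniteDimensional F L]
    [Finite (LieIdeal F L)]
    (hz : LieAlgebra.center F L = ⊥)
    (hfaithful : ∀ I : LieIdeal F L, ¬ LieAlgebra.IsSimple F I) :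
    ∀ I : LieIdeal F L, I ≠ ⊥ → I ⊓ ⁅(⊤ : LieIdeal F L), LieAlgebra.radical F L⁆ ≠ ⊥ := by
  intro I hI h
  have := LieIdeal.isKilling_of_inf_radical_eq_bot (LieIdeal.inf_radical_eq_bot hz h)
  have : Nontrivial I := (LieSubmodule.nontrivial_iff_ne_bot F L L).mpr hI
  obtain ⟨K, hK, -⟩ := (eq_bot_or_exists_atom_le (⊤ : LieIdeal F I)).resolve_left top_ne_bot
  have := LieAlgebra.IsSemisimple.isSimple_of_isAtom K hK
  have hperf : ⁅K, K⁆ = K :=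
    lie_eq_self_of_isAtom_of_nonabelian K hK
      (LieAlgebra.IsSemisimple.non_abelian_of_isAtom K hK)
  exact hfaithful _ (LieAlgebra.IsSimple.of_equiv (LieIdeal.equivOfPerfect K hperf))
end

section
/- Let F be a field of characteristic zero and L a finite-dimensional Lie algebra over F. Suppose A is a nonzero abelian Lie ideal of L and a ∈ L is an element with a ∉ A such that A together with the line F·a spans L (so L = A ⊕ F·a as vector spaces). Let f : A → A denote the restriction to A of the adjoint map x ↦ ⁅a, x⁆, and suppose f is a bijective semisimple endomorphism whose minimal polynomial equals its characteristic polynomial. If the minimal polynomial of f has exactly r distinct monic irreducible factors, then L has exactly 2^r + 1 Lie ideals. -/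
open Polynomial

section InvariantSubmodules

variable {F V : Type*} [Field F] [AddCommGroup V] [Module F V]

theorem aeval_apply_apply (f : Module.End F V) (g : F[X]) (x : V) :
    aeval f g (f x) = f (aeval f g x) := by
  have h : aeval f (g * X) = aeval f (X * g) := by rw [mul_comm]
  simpa using LinearMap.congr_fun h x

theorem coe_aeval_restrict {f : Module.End F V} {W : Submodule F V} (hW : ∀ x ∈ W, f x ∈ W)
    (g : F[X]) (x : W) : (aeval (f.restrict hW) g x : V) = aeval f g x := by
  induction g using Polynomial.induction_on generalizing x with
  | C c => simp
  | add p q hp hq => simp [hp, hq]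
  | monomial n c ih =>
    rw [pow_succ, ← mul_assoc, map_mul _ _ X, map_mul _ _ X, aeval_X, aeval_X]
    exact ih (f.restrict hW x)

theorem ker_aeval_mem_invtSubmodule (f : Module.End F V) (g : F[X]) :
    LinearMap.ker (aeval f g) ∈ f.invtSubmodule := by
  intro x hx
  change aeval f g (f x) = 0
  rw [aeval_apply_apply, LinearMap.mem_ker.mp hx, map_zero]

variable [FiniteDimensional F V]

theorem natDegree_minpoly_le_finrank (f : Module.End F V) :
    (minpoly F f).natDegree ≤ Module.finrank F V :=
  f.charpoly_natDegree ▸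
    natDegree_le_of_dvd (LinearMap.minpoly_dvd_charpoly f) f.charpoly_monic.ne_zero

/-- If the minimal polynomial of `f` has degree `dim V`, then `dim ker g(f) ≤ deg g` for each of
its divisors `g`. -/
theorem finrank_ker_aeval_le_natDegree {f : Module.End F V}
    (hf : (minpoly F f).natDegree = Module.finrank F V) {g h : F[X]}
    (hgh : minpoly F f = g * h) :
    Module.finrank F (LinearMap.ker (aeval f g)) ≤ g.natDegree := by
  have hm : minpoly F f ≠ 0 := minpoly.ne_zero (Algebra.IsIntegral.isIntegral f)
  have hg : g ≠ 0 := left_ne_zero_of_mul (hgh ▸ hm)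
  have hh : h ≠ 0 := right_ne_zero_of_mul (hgh ▸ hm)
  have hinv : ∀ x ∈ LinearMap.range (aeval f g), f x ∈ LinearMap.range (aeval f g) := by
    rintro _ ⟨y, rfl⟩
    exact ⟨f y, aeval_apply_apply f g y⟩
  set k := f.restrict hinv
  have hdvd : minpoly F f ∣ g * minpoly F k := by
    refine minpoly.dvd F f (LinearMap.ext fun y ↦ ?_)
    have hz := congrArg Subtype.val (LinearMap.congr_fun (minpoly.aeval F k) ⟨aeval f g y, y, rfl⟩)
    rw [coe_aeval_restrict] at hz
    rw [mul_comm, map_mul]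
    exact hz
  have hle : h.natDegree ≤ Module.finrank F (LinearMap.range (aeval f g)) := by
    rw [hgh, mul_dvd_mul_iff_left hg] at hdvd
    calc h.natDegree ≤ (minpoly F k).natDegree :=
          natDegree_le_of_dvd hdvd (minpoly.ne_zero (Algebra.IsIntegral.isIntegral k))
      _ ≤ _ := natDegree_minpoly_le_finrank k
  have hrank := (aeval f g).finrank_range_add_finrank_ker
  rw [hgh, natDegree_mul hg hh] at hf
  omega

/-- If the minimal polynomial of `f` has degree `dim V`, then every invariant subspace is the kernel
of `g(f)` for a monic divisor `g` of it. -/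
theorem exists_dvd_minpoly_ker_aeval_eq {f : Module.End F V}
    (hf : (minpoly F f).natDegree = Module.finrank F V) {W : Submodule F V}
    (hW : W ∈ f.invtSubmodule) :
    ∃ g : F[X], g.Monic ∧ g ∣ minpoly F f ∧ LinearMap.ker (aeval f g) = W := by
  set k := f.restrict hW
  have hdvd : minpoly F k ∣ minpoly F f := by
    refine minpoly.dvd F k (LinearMap.ext fun y ↦ Subtype.ext ?_)
    exact (coe_aeval_restrict hW _ y).trans (LinearMap.congr_fun (minpoly.aeval F f) y)
  refine ⟨minpoly F k, minpoly.monic (Algebra.IsIntegral.isIntegral k), hdvd, ?_⟩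
  obtain ⟨h, hh⟩ := hdvd
  refine (Submodule.eq_of_le_of_finrank_le (fun x hx ↦ ?_) ?_).symm
  · exact (coe_aeval_restrict hW _ ⟨x, hx⟩).symm.trans
      (congrArg Subtype.val (LinearMap.congr_fun (minpoly.aeval F k) ⟨x, hx⟩))
  · exact (finrank_ker_aeval_le_natDegree hf hh).trans (natDegree_minpoly_le_finrank k)

theorem dvd_of_ker_aeval_le {f : Module.End F V} {g₁ g₂ : F[X]} (h₂ : g₂ ∣ minpoly F f)
    (hle : LinearMap.ker (aeval f g₂) ≤ LinearMap.ker (aeval f g₁)) : g₂ ∣ g₁ := by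
  obtain ⟨h, hh⟩ := h₂
  have hm : minpoly F f ≠ 0 := minpoly.ne_zero (Algebra.IsIntegral.isIntegral f)
  have hdvd : minpoly F f ∣ g₁ * h := by
    refine minpoly.dvd F f (LinearMap.ext fun y ↦ ?_)
    rw [map_mul]
    refine hle (x := aeval f h y) ?_
    have hz := LinearMap.congr_fun (minpoly.aeval F f) y
    rwa [hh, map_mul] at hz
  rw [hh] at hdvd hm
  exact (mul_dvd_mul_iff_right (right_ne_zero_of_mul hm)).mp hdvd

theorem Polynomial.mem_of_irreducible_dvd_prod {ι : Type*} {p : ι → F[X]}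
    (hirr : ∀ i, Irreducible (p i)) (hmonic : ∀ i, (p i).Monic) (hinj : Function.Injective p)
    {s : Finset ι} {i : ι} (h : p i ∣ ∏ j ∈ s, p j) : i ∈ s := by
  obtain ⟨j, hj, hij⟩ := (hirr i).prime.exists_mem_finset_dvd h
  have := hinj (eq_of_monic_of_associated (hmonic i) (hmonic j)
    ((hirr i).associated_of_dvd (hirr j) hij))
  exact this ▸ hj

theorem Polynomial.exists_eq_prod_of_monic_of_dvd_prod {ι : Type*} [Fintype ι] {p : ι → F[X]}
    (hirr : ∀ i, Irreducible (p i)) (hmonic : ∀ i, (p i).Monic) (hinj : Function.Injective p)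
    {g : F[X]} (hg : g.Monic) (hdvd : g ∣ ∏ i, p i) :
    ∃ s : Finset ι, g = ∏ i ∈ s, p i := by
  classical
  refine ⟨Finset.univ.filter (p · ∣ g), eq_of_monic_of_associated hg (monic_prod_of_monic _ _ fun i _ ↦ hmonic i)
    (associated_of_dvd_dvd ?_ ?_)⟩
  · rw [← Finset.prod_filter_mul_prod_filter_not Finset.univ (fun i ↦ p i ∣ g)] at hdvd
    refine IsCoprime.dvd_of_dvd_mul_right (IsCoprime.prod_right fun i hi ↦ ?_) hdvd
    exact ((hirr i).coprime_iff_not_dvd.mpr (Finset.mem_filter.mp hi).2).symm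
  · refine Finset.prod_dvd_of_coprime (fun i _ j _ hij ↦ ?_) fun i hi ↦ (Finset.mem_filter.mp hi).2
    refine (hirr i).coprime_iff_not_dvd.mpr fun h ↦ hij ?_
    exact hinj (eq_of_monic_of_associated (hmonic i) (hmonic j)
      ((hirr i).associated_of_dvd (hirr j) h))

theorem card_invtSubmodule_of_minpoly_eq_prod {f : Module.End F V}
    (hf : (minpoly F f).natDegree = Module.finrank F V) {ι : Type*} [Fintype ι] {p : ι → F[X]}
    (hirr : ∀ i, Irreducible (p i)) (hmonic : ∀ i, (p i).Monic) (hinj : Function.Injective p)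
    (hfactor : minpoly F f = ∏ i, p i) :
    Nat.card f.invtSubmodule = 2 ^ Fintype.card ι := by
  let φ (s : Finset ι) : f.invtSubmodule :=
    ⟨LinearMap.ker (aeval f (∏ i ∈ s, p i)), ker_aeval_mem_invtSubmodule f _⟩
  have hsub {s t : Finset ι} (hst : φ s = φ t) : s ⊆ t := fun i hi ↦ by
    refine mem_of_irreducible_dvd_prod hirr hmonic hinj ((Finset.dvd_prod_of_mem p hi).trans ?_)
    refine dvd_of_ker_aeval_le ?_ (congrArg Subtype.val hst).le
    exact hfactor ▸ Finset.prod_dvd_prod_of_subset _ _ _ (Finset.subset_univ s)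
  have hφ : Function.Bijective φ := by
    refine ⟨fun s t hst ↦ (hsub hst).antisymm (hsub hst.symm), fun ⟨W, hW⟩ ↦ ?_⟩
    obtain ⟨g, hg, hdvd, hker⟩ := exists_dvd_minpoly_ker_aeval_eq hf hW
    obtain ⟨s, rfl⟩ := exists_eq_prod_of_monic_of_dvd_prod hirr hmonic hinj hg (hfactor ▸ hdvd)
    exact ⟨s, Subtype.ext hker⟩
  rw [← Nat.card_eq_of_bijective φ hφ, Nat.card_eq_fintype_card, Fintype.card_finset]

end InvariantSubmodules

section LieIdeals

variable {F L : Type*} [Field F] [LieRing L] [LieAlgebra F L] {A : LieIdeal F L} {a : L}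

theorem exists_add_smul_of_sup_span_eq_top (hspan : A.toSubmodule ⊔ Submodule.span F {a} = ⊤)
    (x : L) : ∃ y ∈ A, ∃ c : F, y + c • a = x := by
  have hx : x ∈ A.toSubmodule ⊔ Submodule.span F {a} := hspan ▸ Submodule.mem_top
  obtain ⟨y, hy, z, hz, rfl⟩ := Submodule.mem_sup.mp hx
  obtain ⟨c, rfl⟩ := Submodule.mem_span_singleton.mp hz
  exact ⟨y, hy, c, rfl⟩

theorem lie_eq_zero_of_mem_of_isLieAbelian (habelian : IsLieAbelian A) {x y : L}
    (hx : x ∈ A) (hy : y ∈ A) : ⁅x, y⁆ = 0 :=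
  congrArg Subtype.val (habelian.trivial ⟨x, hx⟩ ⟨y, hy⟩)

variable {f : Module.End F A}

theorem LieIdeal.eq_top_of_not_le (habelian : IsLieAbelian A)
    (hspan : A.toSubmodule ⊔ Submodule.span F {a} = ⊤)
    (hf : ∀ x : A, (f x : L) = ⁅a, (x : L)⁆) (hsurj : Function.Surjective f)
    {I : LieIdeal F L} (hI : ¬ I ≤ A) : I = ⊤ := by
  obtain ⟨x, hxI, hxA⟩ := SetLike.not_le_iff_exists.mp hI
  obtain ⟨y, hy, c, rfl⟩ := exists_add_smul_of_sup_span_eq_top hspan x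
  have hc : c ≠ 0 := by
    rintro rfl
    exact hxA (by simpa using hy)
  have hAI : A ≤ I := fun z hz ↦ by
    obtain ⟨w, hw⟩ := hsurj ⟨z, hz⟩
    have hmem : ⁅y + c • a, (w : L)⁆ ∈ I := lie_mem_left F L I _ _ hxI
    rw [add_lie, lie_eq_zero_of_mem_of_isLieAbelian habelian hy w.2, zero_add, smul_lie, ← hf,
      hw] at hmem
    exact (I.toSubmodule.smul_mem_iff hc).mp hmem
  have haI : a ∈ I :=
    (I.toSubmodule.smul_mem_iff hc).mp ((I.toSubmodule.add_mem_iff_right (hAI hy)).mp hxI)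
  refine eq_top_iff.mpr fun z _ ↦ ?_
  obtain ⟨w, hw, d, rfl⟩ := exists_add_smul_of_sup_span_eq_top hspan z
  exact add_mem (hAI hw) (I.toSubmodule.smul_mem d haI)

/-- In `L = A + F·a` with `A` an abelian ideal, the subspaces of `A` invariant under `ad a` are the
Lie ideals of `L` contained in `A`. -/
def LieIdeal.invtSubmoduleEquivIic (habelian : IsLieAbelian A)
    (hspan : A.toSubmodule ⊔ Submodule.span F {a} = ⊤)
    (hf : ∀ x : A, (f x : L) = ⁅a, (x : L)⁆) : f.invtSubmodule ≃ Set.Iic A where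
  toFun W := ⟨{ W.1.map A.toSubmodule.subtype with
      lie_mem := by
        rintro x _ ⟨w, hw, rfl⟩
        obtain ⟨y, hy, c, rfl⟩ := exists_add_smul_of_sup_span_eq_top hspan x
        refine ⟨c • f w, W.1.smul_mem c (W.2 hw), ?_⟩
        have h : ⁅y, (w : L)⁆ = 0 := lie_eq_zero_of_mem_of_isLieAbelian habelian hy w.2
        change ((c • f w : A) : L) = ⁅y + c • a, (w : L)⁆
        rw [add_lie, h, zero_add, smul_lie, ← hf]
        rfl },
    by
      rintro _ ⟨w, _, rfl⟩
      exact w.2⟩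
  invFun I := ⟨I.1.toSubmodule.comap A.toSubmodule.subtype, fun w hw ↦ by
    change (f w : L) ∈ I.1
    rw [hf]
    exact I.1.lie_mem hw⟩
  left_inv W := Subtype.ext
    (Submodule.comap_map_eq_of_injective A.toSubmodule.injective_subtype W.1)
  right_inv I := by
    refine Subtype.ext (LieSubmodule.ext _ _ fun x ↦ ⟨?_, fun hx ↦ ⟨⟨x, I.2 hx⟩, hx, rfl⟩⟩)
    rintro ⟨w, hw, rfl⟩
    exact hw

end LieIdeals

/-- Let `L = A ⊕ F·a` with `A` a nonzero abelian ideal, and suppose the restriction `f`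
of `ad a` to `A` is a bijective semisimple endomorphism whose minimal polynomial equals
its characteristic polynomial.  If the minimal polynomial of `f` has exactly `r` distinct
monic irreducible factors, then `L` has exactly `2 ^ r + 1` Lie ideals. -/
theorem card_lieIdeal_of_abelian_plus_line
    (F : Type*) [Field F] [CharZero F]
    (L : Type*) [LieRing L] [LieAlgebra F L] [FiniteDimensional F L]
    (A : LieIdeal F L) (hA : A ≠ ⊥) (habelian : IsLieAbelian A)
    (a : L) (ha : a ∉ A)
    (hspan : A.toSubmodule ⊔ Submodule.span F {a} = ⊤)
    (f : Module.End F A) (hf : ∀ x : A, (f x : L) = ⁅a, (x : L)⁆)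
    (hbij : Function.Bijective f) (hss : f.IsSemisimple)
    (hminchar : minpoly F f = LinearMap.charpoly f)
    (r : ℕ) (p : Fin r → Polynomial F) (hinj : Function.Injective p)
    (hirr : ∀ i, Irreducible (p i)) (hmonic : ∀ i, (p i).Monic)
    (hfactor : minpoly F f = ∏ i, p i) :
    Nat.card (LieIdeal F L) = 2 ^ r + 1 := by
  have hdeg : (minpoly F f).natDegree = Module.finrank F A := by
    rw [hminchar, LinearMap.charpoly_natDegree]
  have hcard : (Set.Iic A).ncard = 2 ^ r := by
    rw [← Nat.card_coe_set_eq,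
      ← Nat.card_congr (LieIdeal.invtSubmoduleEquivIic habelian hspan hf),
      card_invtSubmodule_of_minpoly_eq_prod hdeg hirr hmonic hinj hfactor, Fintype.card_fin]
  have huniv : (Set.univ : Set (LieIdeal F L)) = insert ⊤ (Set.Iic A) := by
    refine (Set.eq_univ_of_forall fun I ↦ ?_).symm
    by_cases hI : I ≤ A
    · exact .inr hI
    · exact .inl (LieIdeal.eq_top_of_not_le habelian hspan hf hbij.surjective hI)
  have hfin : (Set.Iic A).Finite := Set.finite_of_ncard_ne_zero (by simp [hcard])
  have htop : ⊤ ∉ Set.Iic A := fun h ↦ ha (h (LieSubmodule.mem_top a))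
  rw [← Set.ncard_univ, huniv, Set.ncard_insert_of_notMem htop hfin, hcard]
end
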